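/- Let P, Q ⊂ R^n be lattice polytopes with i = dim(P) and j = dim(Q). If dim(conv(P ∪ Q)) = dim(P) + dim(Q) + 1, then Vol(P) · Vol(Q) divides Vol(conv(P ∪ Q)). -/

import Mathlib

open Pointwise MeasureTheory

noncomputable section

/-- Standard dot product on `Fin n → ℝ`. -/
def dotR {n : ℕ} (c x : Fin n → ℝ) : ℝ := ∑ i, c i * x i

/-- The set of minimizers of the linear functional `x ↦ cᵀx` over `P`. -/
def argminSet {n : ℕ} (c : Fin n → ℝ) (P : Set (Fin n → ℝ)) : Set (Fin n → ℝ) :=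
  {x ∈ P | ∀ y ∈ P, dotR c x ≤ dotR c y}

/-- A polytope: the convex hull of a nonempty finite set of points. -/
def IsPolytope {n : ℕ} (P : Set (Fin n → ℝ)) : Prop :=
  ∃ V : Finset (Fin n → ℝ), V.Nonempty ∧ P = convexHull ℝ (V : Set (Fin n → ℝ))

/-- A lattice polytope: the convex hull of a nonempty finite set of integral points. -/
def IsLatticePolytope {n : ℕ} (P : Set (Fin n → ℝ)) : Prop :=
  ∃ V : Finset (Fin n → ℤ), V.Nonempty ∧
    P = convexHull ℝ ((fun v (i : Fin n) => ((v i : ℤ) : ℝ)) '' (V : Set (Fin n → ℤ)))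

/-- `F` is a face of `P`: either the empty face or the set of minimizers of a
linear functional over `P`. -/
def IsFace {n : ℕ} (P F : Set (Fin n → ℝ)) : Prop :=
  F = ∅ ∨ ∃ c : Fin n → ℝ, F = argminSet c P

/-- The dimension of a set: the rank of the direction space of its affine span. -/
def polyDim {n : ℕ} (P : Set (Fin n → ℝ)) : ℕ :=
  Module.finrank ℝ (affineSpan ℝ P).direction

/-- A point all of whose coordinates are integers. -/
def IsIntPt {m : ℕ} (x : Fin m → ℝ) : Prop := ∀ i, ∃ z : ℤ, x i = (z : ℝ)

/-- An affine chart identifying the affine hull of `P` with `ℝ^r` and mapping the induced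
lattice of integral points bijectively onto `ℤ^r`. -/
def IsLatticeChart {n r : ℕ} (P : Set (Fin n → ℝ))
    (φ : (Fin n → ℝ) →ᵃ[ℝ] (Fin r → ℝ)) : Prop :=
  Set.BijOn (fun x => φ x) (affineSpan ℝ P : Set (Fin n → ℝ)) Set.univ ∧
  ∀ x ∈ affineSpan ℝ P, (IsIntPt x ↔ IsIntPt (φ x))

open Classical in
/-- The normalized volume of a (rational) polytope `P`: `r!` times the Euclidean volume of
the image of `P` under a lattice-preserving affine chart of its affine hull (`r = dim P`).
This is well defined (independent of the chart) and integral for lattice polytopes. -/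
def normVol {n : ℕ} (P : Set (Fin n → ℝ)) : ℝ :=
  (Nat.factorial (polyDim P)) *
    (if h : ∃ φ : (Fin n → ℝ) →ᵃ[ℝ] (Fin (polyDim P) → ℝ), IsLatticeChart P φ
      then (volume ((fun x => h.choose x) '' P)).toReal
      else 0)

/-- The normalized volume is an even integer. -/
def EvenVol {n : ℕ} (P : Set (Fin n → ℝ)) : Prop := ∃ m : ℤ, normVol P = 2 * (m : ℝ)

/-- The class `Q_k`: lattice polytopes all of whose faces of dimension at least `2^k`
have even normalized volume. -/
def InQclass (k : ℕ) {n : ℕ} (P : Set (Fin n → ℝ)) : Prop :=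
  IsLatticePolytope P ∧ ∀ F, IsFace P F → 2 ^ k ≤ polyDim F → EvenVol F

/-- The classes `P_k` of lattice polytopes dual to `k`-hidden-layer integral ReLU networks:
`P_0` consists of single lattice points, and `P_{k+1}` consists of finite Minkowski sums of
convex hulls of unions of pairs of polytopes from `P_k`. -/
def InPclass {n : ℕ} : ℕ → Set (Fin n → ℝ) → Prop
  | 0, P => ∃ v : Fin n → ℤ, P = {fun i => ((v i : ℤ) : ℝ)}
  | k+1, P => ∃ (l : ℕ) (Q : Fin l → Set (Fin n → ℝ)), 0 < l ∧
      (∀ i, ∃ Q₁ Q₂ : Set (Fin n → ℝ), InPclass k Q₁ ∧ InPclass k Q₂ ∧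
        Q i = convexHull ℝ (Q₁ ∪ Q₂)) ∧
      P = ∑ i, Q i

/-- A (polyhedral) subdivision of `R`: a finite collection of polytopes covering `R`,
any two of which intersect in a common face. -/
def IsSubdivision {n : ℕ} (R : Set (Fin n → ℝ)) (𝒞 : Finset (Set (Fin n → ℝ))) : Prop :=
  (∀ C ∈ 𝒞, IsPolytope C) ∧
  (⋃ C ∈ 𝒞, C) = R ∧
  ∀ C ∈ 𝒞, ∀ D ∈ 𝒞, IsFace C (C ∩ D) ∧ IsFace D (C ∩ D)

/-- The standard simplex `Δ^n_0 = conv{0, e_1, …, e_n} ⊆ ℝ^n`. -/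
def stdSimplexPoly (n : ℕ) : Set (Fin n → ℝ) :=
  convexHull ℝ ({0} ∪ Set.range (fun i : Fin n => fun j => if j = i then (1 : ℝ) else 0))


lemma beta_nat (i : ℕ) : ∀ j : ℕ, (∫ t in (0:ℝ)..1, (1 - t) ^ i * t ^ j) * ((i + j + 1).factorial : ℝ)
    = (i.factorial : ℝ) * (j.factorial : ℝ) := by
  induction i with
  | zero =>
    intro j
    simp only [pow_zero, one_mul, zero_add, integral_pow, Nat.factorial_succ, Nat.factorial_zero]
    push_cast
    field_simp
    simp
  | succ i ih =>
    intro j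
    have h1 : ∫ t in (0:ℝ)..1, (((j:ℝ)+1) * ((1 - t) ^ (i+1) * t ^ j) - ((i:ℝ)+1) * ((1-t)^i * t^(j+1))) = 0 := by
      have := intervalIntegral.integral_eq_sub_of_hasDerivAt (a := (0:ℝ)) (b := 1)
        (f := fun t : ℝ => (1-t)^(i+1) * t^(j+1))
        (f' := fun t : ℝ => (((j:ℝ)+1) * ((1 - t) ^ (i+1) * t ^ j) - ((i:ℝ)+1) * ((1-t)^i * t^(j+1)))) ?_ ?_
      · rw [this]; simp
      · intro t _
        have h := ((((hasDerivAt_id t).const_sub 1).pow (i+1)).mul ((hasDerivAt_id t).pow (j+1)))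
        refine h.congr_deriv ?_
        simp only [id, Nat.cast_add, Nat.cast_one, Nat.add_sub_cancel, Pi.pow_apply]
        ring
      · apply Continuous.intervalIntegrable
        fun_prop
    rw [intervalIntegral.integral_sub, intervalIntegral.integral_const_mul,
      intervalIntegral.integral_const_mul] at h1
    · have h2 := ih (j+1)
      rw [show i + (j+1) + 1 = i + 1 + j + 1 by ring] at h2
      rw [Nat.factorial_succ j] at h2
      rw [Nat.factorial_succ i]
      push_cast at h2 ⊢
      have hj : ((j:ℝ)+1) ≠ 0 := by positivity
      apply mul_left_cancel₀ hj
      linear_combination ((i + 1 + j + 1).factorial : ℝ) * h1 + ((i:ℝ)+1) * h2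
    · apply Continuous.intervalIntegrable
      fun_prop
    · apply Continuous.intervalIntegrable
      fun_prop

lemma chart_exists {n : ℕ} (P : Set (Fin n → ℝ)) (hP : IsLatticePolytope P) :
    ∃ φ : (Fin n → ℝ) →ᵃ[ℝ] (Fin (polyDim P) → ℝ), IsLatticeChart P φ := by
  obtain ⟨V, hV, hPV⟩ := hP
  set W : Set (Fin n → ℝ) := (fun v (i : Fin n) => ((v i : ℤ) : ℝ)) '' (V : Set (Fin n → ℤ)) with hW
  have hWint : ∀ w ∈ W, IsIntPt w := by
    rintro _ ⟨v, _, rfl⟩ i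
    exact ⟨v i, rfl⟩
  obtain ⟨v0, hv0⟩ := hV
  have hp0W : (fun i : Fin n => ((v0 i : ℤ) : ℝ)) ∈ W := ⟨v0, hv0, rfl⟩
  set p0 : Fin n → ℝ := (fun i : Fin n => ((v0 i : ℤ) : ℝ)) with hp0
  have hspan : affineSpan ℝ P = affineSpan ℝ W := by rw [hPV, affineSpan_convexHull]
  have hp0i : IsIntPt p0 := hWint _ hp0W
  have hp0S : p0 ∈ affineSpan ℝ P := by rw [hspan]; exact subset_affineSpan ℝ _ hp0W
  set E := (affineSpan ℝ P).direction with hE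
  let Z : Submodule ℤ (Fin n → ℝ) := Submodule.span ℤ (Set.range (Pi.basisFun ℝ (Fin n)))
  have hZ : ∀ x : Fin n → ℝ, x ∈ Z ↔ IsIntPt x := by
    intro x
    rw [Module.Basis.mem_span_iff_repr_mem]
    simp [IsIntPt, eq_comm]
  let L : Submodule ℤ E := ZLattice.comap ℝ Z E.subtype
  have hL : ∀ x : E, x ∈ L ↔ IsIntPt (x : Fin n → ℝ) := fun x => hZ _
  have : DiscreteTopology L :=
    ZLattice.comap_discreteTopology (K := ℝ) (L := Z) (e := E.subtype) (by fun_prop) (Subtype.val_injective)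
  have : IsZLattice ℝ L := by
    constructor
    rw [eq_top_iff]
    have hEs : E = Submodule.span ℝ ((· -ᵥ p0) '' W) := by
      rw [hE, hspan, direction_affineSpan, vectorSpan_eq_span_vsub_set_right ℝ hp0W]
    have h1 : Submodule.map E.subtype ⊤ ≤ Submodule.map E.subtype (Submodule.span ℝ (L : Set E)) := by
      rw [Submodule.map_top, Submodule.range_subtype, Submodule.map_span]
      conv_lhs => rw [hEs]
      apply Submodule.span_mono
      rintro _ ⟨w, hw, rfl⟩
      refine ⟨⟨w -ᵥ p0, AffineSubspace.vsub_mem_direction ?_ hp0S⟩, ?_, rfl⟩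
      · rw [hspan]; exact subset_affineSpan ℝ _ hw
      · show _ ∈ L
        rw [hL]
        intro i
        obtain ⟨a, ha⟩ := hWint w hw i
        obtain ⟨b, hb⟩ := hp0i i
        exact ⟨a - b, by simp [ha, hb]⟩
    exact (Submodule.map_le_map_iff_of_injective Subtype.val_injective _ _).1 h1
  have : Module.Finite ℤ L := ZLattice.module_finite ℝ L
  have : Module.Free ℤ L := ZLattice.module_free ℝ L
  have hr : Module.finrank ℤ L = polyDim P := ZLattice.rank ℝ L
  let b0 : Module.Basis (Fin (polyDim P)) ℤ L := Module.finBasisOfFinrankEq ℤ L hr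
  let b := b0.ofZLatticeBasis ℝ L
  obtain ⟨g, hg⟩ := LinearMap.exists_extend (p := E) (b.equivFun : E →ₗ[ℝ] (Fin (polyDim P) → ℝ))
  have hg' : ∀ x : E, g x = b.equivFun x := fun x => by
    have := LinearMap.congr_fun hg x
    simpa using this
  let φ : (Fin n → ℝ) →ᵃ[ℝ] (Fin (polyDim P) → ℝ) :=
    g.toAffineMap.comp (AffineMap.id ℝ (Fin n → ℝ) - AffineMap.const ℝ (Fin n → ℝ) p0)
  have hφ : ∀ x, φ x = g (x - p0) := fun x => by simp [φ]
  have hdir : ∀ x ∈ affineSpan ℝ P, x - p0 ∈ E := fun x hx =>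
    AffineSubspace.vsub_mem_direction hx hp0S
  refine ⟨φ, ⟨fun _ _ => Set.mem_univ _, ?_, ?_⟩, ?_⟩
  · intro x hx y hy hxy
    simp only [hφ] at hxy
    have h1 := hg' ⟨x - p0, hdir x hx⟩
    have h2 := hg' ⟨y - p0, hdir y hy⟩
    simp only at h1 h2
    rw [h1, h2] at hxy
    have := b.equivFun.injective hxy
    have := congrArg Subtype.val this
    simpa using this
  · intro y _
    refine ⟨((b.equivFun.symm y : E) : Fin n → ℝ) +ᵥ p0, AffineSubspace.vadd_mem_of_mem_direction (Subtype.prop _) hp0S, ?_⟩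
    have h5 : (((b.equivFun.symm y : E) : Fin n → ℝ) +ᵥ p0) - p0 = (b.equivFun.symm y : E) := by
      rw [vadd_eq_add, add_sub_cancel_right]
    show φ (((b.equivFun.symm y : E) : Fin n → ℝ) +ᵥ p0) = y
    rw [hφ, h5, hg', LinearEquiv.apply_symm_apply]
  · intro x hx
    have h1 := hg' ⟨x - p0, hdir x hx⟩
    simp only at h1
    rw [hφ, h1]
    have h2 : IsIntPt x ↔ (⟨x - p0, hdir x hx⟩ : E) ∈ L := by
      rw [hL]
      constructor
      · intro h i
        obtain ⟨a, ha⟩ := h i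
        exact ⟨a - v0 i, by simp [ha, hp0]⟩
      · intro h i
        obtain ⟨a, ha⟩ := h i
        refine ⟨a + v0 i, ?_⟩
        simp only [Pi.sub_apply, hp0] at ha
        push_cast
        linarith
    rw [h2]
    have h3 : L = Submodule.span ℤ (Set.range b) := (b0.ofZLatticeBasis_span ℝ L).symm
    rw [h3, Module.Basis.mem_span_iff_repr_mem]
    simp [IsIntPt, eq_comm]

lemma sub_chart {n i r : ℕ} (P R : Set (Fin n → ℝ)) (φ : (Fin n → ℝ) →ᵃ[ℝ] (Fin i → ℝ))
    (ψ : (Fin n → ℝ) →ᵃ[ℝ] (Fin r → ℝ)) (hφ : IsLatticeChart P φ) (hψ : IsLatticeChart R ψ)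
    (hPR : P ⊆ R) :
    ∃ (c : Fin r → ℤ) (w : Fin i → Fin r → ℤ), ∀ p ∈ P, ∀ m,
      ψ p m = (c m : ℝ) + ∑ k, φ p k * (w k m : ℝ) := by
  obtain ⟨⟨_, hinj, hsurj⟩, hint⟩ := hφ
  have hS : affineSpan ℝ P ≤ affineSpan ℝ R := affineSpan_mono ℝ hPR
  choose g hgS hg using fun y => hsurj (Set.mem_univ y)
  simp only at hg
  have hgi : ∀ y, IsIntPt y → ∀ m, ∃ z : ℤ, ψ (g y) m = z := fun y hy =>
    (hψ.2 _ (hS (hgS y))).1 ((hint _ (hgS y)).2 (by rw [hg]; exact hy))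
  have h0 : IsIntPt (0 : Fin i → ℝ) := fun _ => ⟨0, by simp⟩
  have h1 : ∀ k, IsIntPt (Pi.single k 1 : Fin i → ℝ) := fun k l => by
    by_cases h : l = k
    · subst h; exact ⟨1, by simp⟩
    · exact ⟨0, by simp [h]⟩
  choose c hc using hgi 0 h0
  choose d hd using fun k => hgi _ (h1 k)
  refine ⟨c, fun k m => d k m - c m, ?_⟩
  intro p hp
  have hpS : p ∈ affineSpan ℝ P := subset_affineSpan ℝ _ hp
  have hv : (∑ k, φ p k • (g (Pi.single k 1) - g 0)) ∈ (affineSpan ℝ P).direction :=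
    Submodule.sum_mem _ fun k _ => Submodule.smul_mem _ _
      (AffineSubspace.vsub_mem_direction (hgS _) (hgS _))
  have key : p = (∑ k, φ p k • (g (Pi.single k 1) - g 0)) +ᵥ g 0 := by
    apply hinj hpS (AffineSubspace.vadd_mem_of_mem_direction hv (hgS 0))
    simp only [AffineMap.map_vadd, map_sum, map_smul]
    have : ∀ k, φ.linear (g (Pi.single k 1) - g 0) = Pi.single k 1 := fun k => by
      have := φ.linearMap_vsub (g (Pi.single k 1)) (g 0)
      simp only [vsub_eq_sub] at this
      rw [this, hg, hg, sub_zero]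
    simp only [this, hg]
    ext l
    simp [Pi.single_apply]
  intro m
  have h2 : ψ p = ψ ((∑ k, φ p k • (g (Pi.single k 1) - g 0)) +ᵥ g 0) := congrArg ψ key
  rw [h2]
  simp only [AffineMap.map_vadd, map_sum, map_smul]
  have : ∀ k, ψ.linear (g (Pi.single k 1) - g 0) = ψ (g (Pi.single k 1)) - ψ (g 0) := fun k => by
      have := ψ.linearMap_vsub (g (Pi.single k 1)) (g 0)
      simpa only [vsub_eq_sub] using this
  simp only [this]
  simp [hc, hd, add_comm]

def joinModel {i j : ℕ} (A : Set (Fin i → ℝ)) (B : Set (Fin j → ℝ)) :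
    Set (ℝ × (Fin i → ℝ) × (Fin j → ℝ)) :=
  (fun x : ℝ × (Fin i → ℝ) × (Fin j → ℝ) => (x.1, (1 - x.1) • x.2.1, x.1 • x.2.2)) ''
    (Set.Icc 0 1 ×ˢ (A ×ˢ B))

lemma joinModel_vol {i j : ℕ} (A : Set (Fin i → ℝ)) (B : Set (Fin j → ℝ))
    (hA : IsCompact A) (hB : IsCompact B) :
    (volume (joinModel A B)).toReal * ((i + j + 1).factorial : ℝ) =
      ((i.factorial : ℝ) * (volume A).toReal) * ((j.factorial : ℝ) * (volume B).toReal) := by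
  have hc : IsCompact (joinModel A B) :=
    (isCompact_Icc.prod (hA.prod hB)).image (by fun_prop)
  have hs : ∀ t : ℝ, (Prod.mk t ⁻¹' joinModel A B) =
      if t ∈ Set.Icc (0:ℝ) 1 then ((1 - t) • A) ×ˢ (t • B) else ∅ := by
    intro t
    ext ⟨x, y⟩
    split_ifs with ht
    · simp only [joinModel, Set.mem_preimage, Set.mem_image, Set.mem_prod, Prod.exists, Prod.mk.injEq,
        Set.mem_smul_set]
      constructor
      · rintro ⟨s, a, b, ⟨_, ha, hb⟩, rfl, h1, h2⟩
        exact ⟨⟨a, ha, h1⟩, ⟨b, hb, h2⟩⟩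
      · rintro ⟨⟨a, ha, h1⟩, ⟨b, hb, h2⟩⟩
        exact ⟨t, a, b, ⟨ht, ha, hb⟩, rfl, h1, h2⟩
    · simp only [joinModel, Set.mem_preimage, Set.mem_image, Set.mem_prod, Prod.exists, Prod.mk.injEq,
        Set.mem_empty_iff_false, iff_false]
      rintro ⟨s, a, b, ⟨hs, ha, hb⟩, rfl, h1, h2⟩
      exact ht hs
  have hv : volume (joinModel A B) =
      ENNReal.ofReal (∫ t in (0:ℝ)..1, (1 - t) ^ i * t ^ j) * (volume A * volume B) := by
    rw [Measure.volume_eq_prod, Measure.prod_apply hc.measurableSet]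
    have : ∀ t : ℝ, volume (Prod.mk t ⁻¹' joinModel A B) =
        (Set.Icc (0:ℝ) 1).indicator
          (fun t => ENNReal.ofReal ((1 - t) ^ i * t ^ j) * (volume A * volume B)) t := by
      intro t
      rw [hs]
      by_cases ht : t ∈ Set.Icc (0:ℝ) 1
      · have h1 : 0 ≤ (1 - t) ^ i := pow_nonneg (by linarith [ht.2]) _
        have h2 : 0 ≤ t ^ j := pow_nonneg ht.1 _
        rw [if_pos ht, Set.indicator_of_mem ht, Measure.volume_eq_prod, Measure.prod_prod,
          Measure.addHaar_smul, Measure.addHaar_smul, ENNReal.ofReal_mul h1]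
        simp only [Module.finrank_fin_fun, abs_of_nonneg h1, abs_of_nonneg h2]
        ring
      · rw [if_neg ht, Set.indicator_of_notMem ht, measure_empty]
    simp only [this]
    rw [lintegral_indicator measurableSet_Icc, lintegral_mul_const _ (by fun_prop),
      intervalIntegral.integral_of_le zero_le_one, ← integral_Icc_eq_integral_Ioc,
      ofReal_integral_eq_lintegral_ofReal]
    · exact (Continuous.integrableOn_Icc (by fun_prop))
    · filter_upwards [ae_restrict_mem measurableSet_Icc] with t ht
      exact mul_nonneg (pow_nonneg (by linarith [ht.2]) _) (pow_nonneg ht.1 _)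
  rw [hv, ENNReal.toReal_mul, ENNReal.toReal_mul, ENNReal.toReal_ofReal]
  · linear_combination ((volume A).toReal * (volume B).toReal) * beta_nat i j
  · apply intervalIntegral.integral_nonneg zero_le_one
    intro t ht
    exact mul_nonneg (pow_nonneg (by linarith [ht.2]) _) (pow_nonneg ht.1 _)

lemma exists_coords {i j r : ℕ} (hr : r = i + j + 1) :
    ∃ (σ : Unit ⊕ (Fin i ⊕ Fin j) ≃ Fin r),
      ∀ M : Set (ℝ × (Fin i → ℝ) × (Fin j → ℝ)),
        volume {f : Fin r → ℝ | (f (σ (Sum.inl ())), (fun k => f (σ (Sum.inr (Sum.inl k)))),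
          (fun k => f (σ (Sum.inr (Sum.inr k))))) ∈ M} = volume M := by
  have hcard : Fintype.card (Unit ⊕ (Fin i ⊕ Fin j)) = Fintype.card (Fin r) := by
    simp [hr]; ring
  let σ := Fintype.equivOfCardEq hcard
  refine ⟨σ, fun M => ?_⟩
  have h1 := (volume_measurePreserving_piCongrLeft (fun _ : Fin r => ℝ) σ).symm
  have h2 := volume_measurePreserving_sumPiEquivProdPi (fun _ : Unit ⊕ (Fin i ⊕ Fin j) => ℝ)
  have h3 := volume_measurePreserving_sumPiEquivProdPi (fun _ : (Fin i ⊕ Fin j) => ℝ)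
  have h4 := volume_preserving_funUnique Unit ℝ
  let e1 := (MeasurableEquiv.piCongrLeft (fun _ : Fin r => ℝ) σ).symm
  let e2 := MeasurableEquiv.sumPiEquivProdPi (fun _ : Unit ⊕ (Fin i ⊕ Fin j) => ℝ)
  let e3 := MeasurableEquiv.sumPiEquivProdPi (fun _ : (Fin i ⊕ Fin j) => ℝ)
  let e4 := MeasurableEquiv.funUnique Unit ℝ
  let e := (e1.trans e2).trans (e4.prodCongr e3)
  have h : MeasurePreserving e volume volume := (h4.prod h3).comp (h2.comp h1)
  have := h.measure_preimage_equiv M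
  rw [← this]
  rfl

lemma main_vol {i j r : ℕ} (hr : r = i + j + 1) (A : Set (Fin i → ℝ)) (B : Set (Fin j → ℝ))
    (hA : IsCompact A) (hB : IsCompact B) (c d : Fin r → ℤ)
    (w : Fin i → Fin r → ℤ) (u : Fin j → Fin r → ℤ) (R : Set (Fin r → ℝ))
    (hR : ∀ y, y ∈ R ↔ ∃ t ∈ Set.Icc (0:ℝ) 1, ∃ a ∈ A, ∃ b ∈ B, ∀ m,
      y m = (1 - t) * ((c m : ℝ) + ∑ k, a k * (w k m : ℝ)) + t * ((d m : ℝ) + ∑ k, b k * (u k m : ℝ))) :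
    ∃ z : ℤ, (r.factorial : ℝ) * (volume R).toReal =
      z * (((i.factorial : ℝ) * (volume A).toReal) * ((j.factorial : ℝ) * (volume B).toReal)) := by
  obtain ⟨σ, hσ⟩ := exists_coords hr
  let col : Unit ⊕ (Fin i ⊕ Fin j) → Fin r → ℤ :=
    Sum.elim (fun _ m => d m - c m) (Sum.elim w u)
  let N : Matrix (Fin r) (Fin r) ℤ := Matrix.of fun m k => col (σ.symm k) m
  let NR : Matrix (Fin r) (Fin r) ℝ := N.map (Int.castRingHom ℝ)
  have hdet : LinearMap.det (Matrix.toLin' NR) = (N.det : ℝ) := by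
    rw [LinearMap.det_toLin']
    exact (RingHom.map_det (Int.castRingHom ℝ) N).symm
  have happ : ∀ (f : Fin r → ℝ) m, Matrix.toLin' NR f m =
      f (σ (Sum.inl ())) * ((d m : ℝ) - c m) + (∑ k, f (σ (Sum.inr (Sum.inl k))) * (w k m : ℝ) +
        ∑ k, f (σ (Sum.inr (Sum.inr k))) * (u k m : ℝ)) := by
    intro f m
    rw [Matrix.toLin'_apply, Matrix.mulVec, dotProduct, ← σ.sum_comp, Fintype.sum_sum_type,
      Fintype.sum_sum_type]
    simp [NR, N, col, mul_comm]
  set M' := {f : Fin r → ℝ | (f (σ (Sum.inl ())), (fun k => f (σ (Sum.inr (Sum.inl k)))),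
          (fun k => f (σ (Sum.inr (Sum.inr k))))) ∈ joinModel A B} with hM'
  have himg : R = (fun m => (c m : ℝ)) +ᵥ ((Matrix.toLin' NR) '' M') := by
    ext y
    rw [hR, Set.mem_vadd_set]
    constructor
    · rintro ⟨t, ht, a, ha, b, hb, hy⟩
      let f0 : Unit ⊕ (Fin i ⊕ Fin j) → ℝ :=
        Sum.elim (fun _ => t) (Sum.elim (fun k => (1 - t) * a k) (fun k => t * b k))
      refine ⟨_, ⟨fun k => f0 (σ.symm k), ?_, rfl⟩, ?_⟩
      · refine ⟨(t, a, b), ⟨ht, ha, hb⟩, ?_⟩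
        simp only [Equiv.symm_apply_apply, f0]
        rfl
      · ext m
        rw [vadd_eq_add, Pi.add_apply, happ, hy]
        simp only [Equiv.symm_apply_apply, f0, Sum.elim_inl, Sum.elim_inr, mul_assoc, ← Finset.mul_sum]
        ring
    · rintro ⟨_, ⟨f, ⟨⟨t, a, b⟩, ⟨ht, ha, hb⟩, hf⟩, rfl⟩, rfl⟩
      refine ⟨t, ht, a, ha, b, hb, fun m => ?_⟩
      simp only [Prod.mk.injEq] at hf
      obtain ⟨h1, h2, h3⟩ := hf
      rw [vadd_eq_add, Pi.add_apply, happ, ← h1]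
      have h2' := fun k => congrFun h2 k
      have h3' := fun k => congrFun h3 k
      simp only [Pi.smul_apply, smul_eq_mul] at h2' h3'
      simp only [← h2', ← h3', mul_assoc, ← Finset.mul_sum]
      ring
  refine ⟨|N.det|, ?_⟩
  rw [himg, measure_vadd, Measure.addHaar_image_linearMap, hdet, hσ, ENNReal.toReal_mul,
    ENNReal.toReal_ofReal (abs_nonneg _), ← joinModel_vol A B hA hB]
  have hf : (r.factorial : ℝ) = ((i + j + 1).factorial : ℝ) := by rw [hr]
  rw [hf]
  push_cast
  ring

lemma lattice_compact {n : ℕ} {P : Set (Fin n → ℝ)} (hP : IsLatticePolytope P) :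
    IsCompact P ∧ Convex ℝ P ∧ P.Nonempty := by
  obtain ⟨V, hV, rfl⟩ := hP
  refine ⟨Set.Finite.isCompact_convexHull ℝ (Set.Finite.image _ (Finset.finite_toSet V)), convex_convexHull ℝ _, ?_⟩
  rw [convexHull_nonempty_iff]
  exact Set.Nonempty.image _ (Finset.coe_nonempty.2 hV)

/-- If `P, Q` are lattice polytopes with `dim conv(P ∪ Q) = dim P + dim Q + 1`, then
`Vol(P) · Vol(Q)` divides `Vol(conv(P ∪ Q))`. -/
theorem normVol_join_divisibility {n : ℕ} (P Q : Set (Fin n → ℝ))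
    (hP : IsLatticePolytope P) (hQ : IsLatticePolytope Q)
    (hdim : polyDim (convexHull ℝ (P ∪ Q)) = polyDim P + polyDim Q + 1) :
    ∃ z : ℤ, normVol (convexHull ℝ (P ∪ Q)) = (z : ℝ) * (normVol P * normVol Q) := by
  by_cases hR : ∃ φ : (Fin n → ℝ) →ᵃ[ℝ] (Fin (polyDim (convexHull ℝ (P ∪ Q))) → ℝ),
      IsLatticeChart (convexHull ℝ (P ∪ Q)) φ
  swap
  · exact ⟨0, by simp [normVol, hR]⟩
  have hP' := chart_exists P hP
  have hQ' := chart_exists Q hQ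
  obtain ⟨cP, vP, nP⟩ := lattice_compact hP
  obtain ⟨cQ, vQ, nQ⟩ := lattice_compact hQ
  unfold normVol
  rw [dif_pos hR, dif_pos hP', dif_pos hQ']
  have sR := hR.choose_spec
  have sP := hP'.choose_spec
  have sQ := hQ'.choose_spec
  generalize hR.choose = ψ at *
  generalize hP'.choose = φ at *
  generalize hQ'.choose = χ at *
  obtain ⟨c, w, hw⟩ := sub_chart P _ φ ψ sP sR
    (Set.subset_union_left.trans (subset_convexHull ℝ _))
  obtain ⟨d, u, hu⟩ := sub_chart Q _ χ ψ sQ sR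
    (Set.subset_union_right.trans (subset_convexHull ℝ _))
  have hcl : ∀ (t : ℝ) (p q : Fin n → ℝ) m, ψ (AffineMap.lineMap p q t) m =
      (1 - t) * ψ p m + t * ψ q m := by
    intro t p q m
    rw [AffineMap.apply_lineMap, AffineMap.lineMap_apply_module]
    simp
  refine main_vol hdim _ _ (cP.image φ.continuous_of_finiteDimensional)
    (cQ.image χ.continuous_of_finiteDimensional) c d w u _ ?_
  intro y
  have hU := vP.convexHull_union vQ nP nQ
  constructor
  · rintro ⟨x, hx, rfl⟩
    obtain ⟨p, hp, q, hq, hx⟩ := mem_convexJoin.1 (hU.subset hx)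
    rw [segment_eq_image_lineMap] at hx
    obtain ⟨t, ht, rfl⟩ := hx
    refine ⟨t, ht, _, ⟨p, hp, rfl⟩, _, ⟨q, hq, rfl⟩, fun m => ?_⟩
    simp only
    rw [hcl, hw p hp, hu q hq]
  · rintro ⟨t, ht, _, ⟨p, hp, rfl⟩, _, ⟨q, hq, rfl⟩, hy⟩
    refine ⟨AffineMap.lineMap p q t, hU.symm.subset (mem_convexJoin.2 ⟨p, hp, q, hq, ?_⟩), ?_⟩
    · rw [segment_eq_image_lineMap]
      exact ⟨t, ht, rfl⟩
    · ext m
      simp only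
      rw [hcl, hw p hp, hu q hq, hy]

end
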